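/- For every finite lattice R, there exists k ∈ ℕ such that the full shift R^ℤ with the cellwise lattice operations is k-shallow: every affine map of R^ℤ is equal, as a function R^ℤ → R^ℤ, to an affine map given by an expression of depth at most k. -/

import Mathlib

/-- Affine maps of an algebra with two binary operations `m`, `j`, together with the
depth of a defining expression: the identity and the constants have depth `0`, and
applying `m` or `j` with a constant increases the depth by one. -/
inductive IsAffineDepth {α : Type*} (m j : α → α → α) : ℕ → (α → α) → Prop
  | id : IsAffineDepth m j 0 (fun x => x)
  | const (c : α) : IsAffineDepth m j 0 (fun _ => c)
  | meet (d : ℕ) (t : α → α) (c : α) (ht : IsAffineDepth m j d t) :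
      IsAffineDepth m j (d + 1) (fun x => m (t x) c)
  | join (d : ℕ) (t : α → α) (c : α) (ht : IsAffineDepth m j d t) :
      IsAffineDepth m j (d + 1) (fun x => j (t x) c)

/-- `IsMeetJoinIterate n f`: the function `f` arises from the identity by `n` rounds, each of
which meets with a constant and then joins with a constant. -/
inductive IsMeetJoinIterate {R : Type*} [Lattice R] : ℕ → (R → R) → Prop
  | id : IsMeetJoinIterate 0 (fun x => x)
  | step (n : ℕ) (f : R → R) (a b : R) (hf : IsMeetJoinIterate n f) :
      IsMeetJoinIterate (n + 1) (fun x => f x ⊓ a ⊔ b)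

namespace IsMeetJoinIterate

theorem mono {R : Type*} [Lattice R] [BoundedOrder R] {m n : ℕ} {f : R → R}
    (hf : IsMeetJoinIterate m f) (hmn : m ≤ n) : IsMeetJoinIterate n f := by
  induction n, hmn using Nat.le_induction with
  | base => exact hf
  | succ n _ ih => simpa using ih.step n f ⊤ ⊥

/-- There are finitely many functions on a finite lattice, so a common number of rounds
suffices for all the iterates. -/
theorem exists_uniform (R : Type*) [Finite R] [Lattice R] [BoundedOrder R] :
    ∃ N : ℕ, ∀ (n : ℕ) (f : R → R), IsMeetJoinIterate n f → IsMeetJoinIterate N f := by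
  have h : ∀ f : R → R, ∃ N : ℕ, ∀ n, IsMeetJoinIterate n f → IsMeetJoinIterate N f := by
    intro f
    by_cases hf : ∃ n, IsMeetJoinIterate n f
    · exact hf.imp fun N hN _ _ => hN
    · exact ⟨0, fun n hn => (hf ⟨n, hn⟩).elim⟩
  choose N hN using h
  obtain ⟨M, hM⟩ := (Set.finite_range N).bddAbove
  exact ⟨M, fun n f hf => (hN f n hf).mono (hM ⟨f, rfl⟩)⟩

/-- A map acting on each cell by `n` rounds has affine depth at most `2 * n`, since all cells can
be processed in parallel. -/
theorem isAffineDepth_pi {ι R : Type*} [Lattice R] (n : ℕ) (f : ι → R → R)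
    (hf : ∀ i, IsMeetJoinIterate n (f i)) :
    IsAffineDepth (fun x y : ι → R => fun i => x i ⊓ y i)
      (fun x y : ι → R => fun i => x i ⊔ y i) (2 * n) (fun x i => f i (x i)) := by
  induction n generalizing f with
  | zero =>
    have h : f = fun _ x => x := funext fun i => by
      have hi := hf i
      generalize f i = u at hi
      cases hi
      rfl
    subst h
    exact .id
  | succ n ih =>
    have h : ∀ i, ∃ (g : R → R) (a b : R),
        IsMeetJoinIterate n g ∧ f i = fun x => g x ⊓ a ⊔ b := fun i => by
      have hi := hf i
      generalize f i = u at hi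
      cases hi with
      | step _ g a b hg => exact ⟨g, a, b, hg, rfl⟩
    choose g a b hg hfg using h
    obtain rfl : f = fun i x => g i x ⊓ a i ⊔ b i := funext hfg
    exact .join _ _ b (.meet _ _ a (ih g hg))

end IsMeetJoinIterate

/-- An affine map of a power of `R` acts on each cell by iterated meets and joins. -/
theorem IsAffineDepth.exists_isMeetJoinIterate {ι R : Type*} [Lattice R] [BoundedOrder R]
    {d : ℕ} {t : (ι → R) → (ι → R)}
    (ht : IsAffineDepth (fun x y : ι → R => fun i => x i ⊓ y i)
      (fun x y : ι → R => fun i => x i ⊔ y i) d t) (i : ι) :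
    ∃ (n : ℕ) (f : R → R), IsMeetJoinIterate n f ∧ ∀ x, t x i = f (x i) := by
  induction ht with
  | id => exact ⟨0, _, .id, fun _ => rfl⟩
  | const c => exact ⟨1, _, .step 0 _ (c i) (c i) .id, fun x => by simp⟩
  | meet d t c _ ih =>
    obtain ⟨n, f, hf, h⟩ := ih
    exact ⟨n + 1, _, .step n f (c i) ⊥ hf, fun x => by simp [h]⟩
  | join d t c _ ih =>
    obtain ⟨n, f, hf, h⟩ := ih
    exact ⟨n + 1, _, .step n f ⊤ (c i) hf, fun x => by simp [h]⟩

/-- Theorem: for every finite lattice `R`, the full shift `R^ℤ` with the cellwise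
lattice operations is `k`-shallow for some `k`: every affine map of `R^ℤ` equals,
as a function, one given by an expression of depth at most `k`. -/
theorem stmt9 {R : Type*} [Fintype R] [Lattice R] :
    ∃ k : ℕ, ∀ (d : ℕ) (t : (ℤ → R) → (ℤ → R)),
      IsAffineDepth (fun x y : ℤ → R => fun i => x i ⊓ y i)
        (fun x y : ℤ → R => fun i => x i ⊔ y i) d t →
      ∃ d' ≤ k, IsAffineDepth (fun x y : ℤ → R => fun i => x i ⊓ y i)
        (fun x y : ℤ → R => fun i => x i ⊔ y i) d' t := by
  cases isEmpty_or_nonempty R with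
  | inl _ =>
    refine ⟨0, fun d t _ => ⟨0, le_rfl, ?_⟩⟩
    rw [Subsingleton.elim t fun x => x]
    exact .id
  | inr _ =>
    let _ : BoundedOrder R := Fintype.toBoundedOrder R
    obtain ⟨N, hN⟩ := IsMeetJoinIterate.exists_uniform R
    refine ⟨2 * N, fun d t ht => ⟨2 * N, le_rfl, ?_⟩⟩
    choose n f hf htf using ht.exists_isMeetJoinIterate
    obtain rfl : t = fun x i => f i (x i) := funext fun x => funext fun i => htf i x
    exact IsMeetJoinIterate.isAffineDepth_pi N f fun i => hN _ _ (hf i)
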